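/- arXiv:1405.3872 — 2 statements merged into one kernel-verified Lean document; each statement's English description precedes it below -/
import Mathlib

section
/- Let p be a prime and G a nontrivial finite p-group with an unmixed Beauville structure ((x,y,z),(a,b,c)). Then for every natural number N there exist a finite p-group H with Nat.card H ≥ N, a surjective group homomorphism φ : H → G, and an unmixed Beauville structure ((x',y',z'),(a',b',c')) on H such that φ maps x', y', z', a', b', c' to x, y, z, a, b, c respectively, and orderOf x' = orderOf x, orderOf y' = orderOf y, orderOf z' = orderOf z (so the signature of the first half is preserved). -/
def IsBeauvilleStructure {G : Type*} [Group G] (x y z a b c : G) : Prop :=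
  x * y * z = 1 ∧ a * b * c = 1 ∧
  Subgroup.closure {x, y, z} = ⊤ ∧ Subgroup.closure {a, b, c} = ⊤ ∧
  ∀ u ∈ ({x, y, z} : Set G), ∀ v ∈ ({a, b, c} : Set G), ∀ g : G, ∀ i j : ℤ,
    u ^ i = g * v ^ j * g⁻¹ → u ^ i = 1

namespace BeauvilleAux

theorem additive_zero {G K : Type*} [Group G] [Field K] {x y : G}
    (hc : Subgroup.closure {x, y} = ⊤) (F : G → K) (hF : ∀ g h, F (g * h) = F g + F h)
    (hx : F x = 0) (hy : F y = 0) (g : G) : F g = 0 := by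
  have h1 : F 1 = 0 := by
    have := hF 1 1
    simp at this
    exact this
  have hg : g ∈ Subgroup.closure ({x, y} : Set G) := by rw [hc]; trivial
  induction hg using Subgroup.closure_induction with
  | mem u hu =>
    rcases hu with rfl | rfl
    · exact hx
    · exact hy
  | one => exact h1
  | mul u v _ _ hu hv => rw [hF, hu, hv, add_zero]
  | inv u _ hu =>
    have := hF u u⁻¹
    rw [mul_inv_cancel, h1, hu, zero_add] at this
    exact this.symm

theorem exists_char {p : ℕ} (hp : p.Prime) {G : Type*} [Group G] [Finite G] (hG : IsPGroup p G)
    (M : Subgroup G) (hM : IsCoatom M) :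
    ∃ f : G → ZMod p, (∀ g h, f (g * h) = f g + f h) ∧ ∀ g, f g = 0 ↔ g ∈ M := by
  have : Fact p.Prime := ⟨hp⟩
  have : Group.IsNilpotent G := hG.isNilpotent
  have hn : M.Normal :=
    Subgroup.NormalizerCondition.normal_of_coatom M Group.normalizerCondition_of_isNilpotent hM
  have hQ : IsPGroup p (G ⧸ M) := hG.to_quotient M
  have : Nontrivial (G ⧸ M) := by
    rw [QuotientGroup.nontrivial_iff]
    exact hM.1
  have hdvd : p ∣ Nat.card (G ⧸ M) := by
    obtain ⟨n, hn, h⟩ := hQ.nontrivial_iff_card.1 inferInstance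
    rw [h]
    exact dvd_pow_self p hn.ne'
  obtain ⟨q, hq⟩ := exists_prime_orderOf_dvd_card' p hdvd
  have htop : Subgroup.zpowers q = ⊤ := by
    have hle : M ≤ (Subgroup.zpowers q).comap (QuotientGroup.mk' M) := by
      intro m hm
      have : (QuotientGroup.mk' M) m = 1 := by simpa using hm
      rw [Subgroup.mem_comap, this]
      exact one_mem _
    rcases hM.le_iff.1 hle with h | h
    · rw [eq_top_iff]
      intro r _
      obtain ⟨g, rfl⟩ := QuotientGroup.mk'_surjective M r
      have : g ∈ (Subgroup.zpowers q).comap (QuotientGroup.mk' M) := by rw [h]; trivial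
      exact this
    · exfalso
      obtain ⟨g, rfl⟩ := QuotientGroup.mk'_surjective M q
      have : g ∈ (Subgroup.zpowers (QuotientGroup.mk' M g)).comap (QuotientGroup.mk' M) :=
        Subgroup.mem_zpowers _
      rw [h] at this
      have h1 : (QuotientGroup.mk' M) g = 1 := by simpa using this
      rw [h1, orderOf_one] at hq
      exact hp.one_lt.ne hq
  have hcard : Nat.card (G ⧸ M) = p := by
    rw [← hq, ← Nat.card_zpowers, htop, Subgroup.card_top]
  have hcard2 : Nat.card (Multiplicative (ZMod p)) = p := by
    simp
  let e : (G ⧸ M) ≃* Multiplicative (ZMod p) := mulEquivOfPrimeCardEq hcard hcard2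
  refine ⟨fun g => (e (QuotientGroup.mk' M g)).toAdd, ?_, ?_⟩
  · intro g h
    simp
  · intro g
    rw [toAdd_eq_zero, EmbeddingLike.map_eq_one_iff]
    simp

theorem gen_lift {p : ℕ} (hp : p.Prime) {G H : Type*} [Group G] [Finite G] (hG : IsPGroup p G)
    [Group H] [Finite H] (hH : IsPGroup p H) (π : H →* G) {x y : H}
    (hc : Subgroup.closure {x, y} = ⊤) (hπ : Function.Surjective π)
    {M₁ M₂ : Subgroup G} (h₁ : IsCoatom M₁) (h₂ : IsCoatom M₂) (hne : M₁ ≠ M₂)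
    (S : Set H) (hS : Subgroup.closure (π '' S) = ⊤) : Subgroup.closure S = ⊤ := by
  have : Fact p.Prime := ⟨hp⟩
  by_contra hcon
  obtain ⟨M, hM, hSM⟩ := (eq_top_or_exists_le_coatom (Subgroup.closure S)).resolve_left hcon
  obtain ⟨f, hf, hfM⟩ := exists_char hp hH M hM
  obtain ⟨f₁, hf₁, hfM₁⟩ := exists_char hp hG M₁ h₁
  obtain ⟨f₂, hf₂, hfM₂⟩ := exists_char hp hG M₂ h₂
  have hker : ∀ k, π k = 1 → f k = 0 := by
    by_cases hd : f₁ (π x) * f₂ (π y) - f₂ (π x) * f₁ (π y) = 0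
    · exfalso
      have e1 := additive_zero hc (fun g => f₂ (π y) * f₁ (π g) - f₁ (π y) * f₂ (π g))
        (by intro g h; simp only [map_mul, hf₁, hf₂]; ring) (by linear_combination hd) (by ring)
      have e2 := additive_zero hc (fun g => f₂ (π x) * f₁ (π g) - f₁ (π x) * f₂ (π g))
        (by intro g h; simp only [map_mul, hf₁, hf₂]; ring) (by ring) (by linear_combination -hd)
      have : ¬ M₁ ≤ M₂ := by
        intro hle
        rcases h₁.le_iff.1 hle with h | h
        · exact h₂.1 h
        · exact hne h.symm
      obtain ⟨g, hg1, hg2⟩ := SetLike.not_le_iff_exists.1 this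
      rw [← hfM₁] at hg1
      rw [← hfM₂] at hg2
      obtain ⟨g, rfl⟩ := hπ g
      have e1g := e1 g
      have e2g := e2 g
      simp only [hg1, mul_zero, zero_sub, neg_eq_zero, mul_eq_zero, hg2, or_false] at e1g e2g
      apply h₁.1
      rw [eq_top_iff]
      intro r _
      obtain ⟨r, rfl⟩ := hπ r
      rw [← hfM₁]
      exact additive_zero hc (fun g => f₁ (π g)) (by intro g h; simp only [map_mul, hf₁]) e2g e1g r
    · have e := additive_zero hc (fun g => (f₁ (π x) * f₂ (π y) - f₂ (π x) * f₁ (π y)) * f g -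
        ((f x * f₂ (π y) - f y * f₂ (π x)) * f₁ (π g) +
          (f₁ (π x) * f y - f₁ (π y) * f x) * f₂ (π g)))
        (by intro g h; simp only [map_mul, hf₁, hf₂, hf]; ring) (by ring) (by ring)
      intro k hk
      have := e k
      have z1 : f₁ 1 = 0 := (hfM₁ 1).2 (one_mem _)
      have z2 : f₂ 1 = 0 := (hfM₂ 1).2 (one_mem _)
      simp only [hk, z1, z2, mul_zero, add_zero, sub_zero, mul_eq_zero, hd, false_or] at this
      exact this
  apply hM.1
  rw [eq_top_iff]
  intro h _
  have : π h ∈ (Subgroup.closure S).map π := by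
    rw [MonoidHom.map_closure, hS]; trivial
  obtain ⟨s, hs, hsh⟩ := this
  have hk : f (s⁻¹ * h) = 0 := hker _ (by rw [map_mul, map_inv, hsh, inv_mul_cancel])
  have := mul_mem (hSM hs) ((hfM _).1 hk)
  simpa using this

theorem two_coatoms {G : Type*} [Group G] [Finite G] [Nontrivial G] {x y z a b c : G}
    (hB : IsBeauvilleStructure x y z a b c) :
    ∃ M₁ M₂ : Subgroup G, IsCoatom M₁ ∧ IsCoatom M₂ ∧ M₁ ≠ M₂ := by
  obtain ⟨-, -, h1, h2, h⟩ := hB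
  by_contra! hcon
  obtain ⟨M, hM, -⟩ := (eq_top_or_exists_le_coatom (⊥ : Subgroup G)).resolve_left bot_ne_top
  have hgen : ∀ g, g ∉ M → Subgroup.zpowers g = ⊤ := by
    intro g hg
    rcases eq_top_or_exists_le_coatom (Subgroup.zpowers g) with h | ⟨M', hM', hle⟩
    · exact h
    · rw [← hcon M M' hM hM'] at hle
      exact absurd (hle (Subgroup.mem_zpowers g)) hg
  have hex : ∀ S : Set G, Subgroup.closure S = ⊤ → ∃ u ∈ S, u ∉ M := by
    intro S hS
    by_contra! hh
    apply hM.1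
    rw [eq_top_iff, ← hS, Subgroup.closure_le]
    exact hh
  obtain ⟨u, hu, huM⟩ := hex _ h1
  obtain ⟨v, hv, hvM⟩ := hex _ h2
  have : u ∈ Subgroup.zpowers v := by rw [hgen v hvM]; trivial
  obtain ⟨j, hj⟩ := this
  have := h u hu v hv 1 1 j (by simpa using hj.symm)
  rw [zpow_one] at this
  exact huM (this ▸ one_mem M)

theorem no_cyclic {G : Type*} [Group G] [Nontrivial G] {a b c u : G}
    (h2 : Subgroup.closure {a, b, c} = ⊤)
    (hu : ∀ v ∈ ({a, b, c} : Set G), ∀ g : G, ∀ i j : ℤ,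
      u ^ i = g * v ^ j * g⁻¹ → u ^ i = 1) : Subgroup.zpowers u ≠ ⊤ := by
  intro ht
  have : Subgroup.closure {a, b, c} ≤ (⊥ : Subgroup G) := by
    rw [Subgroup.closure_le]
    intro v hv
    have : v ∈ Subgroup.zpowers u := by rw [ht]; trivial
    obtain ⟨i, hi⟩ := this
    simp only at hi
    have := hu v hv 1 i 1 (by simpa using hi)
    rw [hi] at this
    simpa using this
  rw [h2] at this
  exact bot_ne_top (top_le_iff.1 this)

theorem no_dihedral {G : Type*} [Group G] {a b c u v : G}
    (hu2 : u * u = 1) (hv2 : v * v = 1) (hu1 : u ≠ 1) (hv1 : v ≠ 1)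
    (h1 : Subgroup.closure {u, v} = ⊤)
    (h2 : Subgroup.closure {a, b, c} = ⊤)
    (hu : ∀ t ∈ ({a, b, c} : Set G), ∀ g : G, ∀ i j : ℤ,
      u ^ i = g * t ^ j * g⁻¹ → u ^ i = 1)
    (hv : ∀ t ∈ ({a, b, c} : Set G), ∀ g : G, ∀ i j : ℤ,
      v ^ i = g * t ^ j * g⁻¹ → v ^ i = 1) : False := by
  have hui : u⁻¹ = u := inv_eq_of_mul_eq_one_right hu2
  have hvi : v⁻¹ = v := inv_eq_of_mul_eq_one_right hv2
  obtain ⟨w, hw⟩ : ∃ w, w = u * v := ⟨_, rfl⟩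
  have hwi : w⁻¹ = v * u := by rw [hw, mul_inv_rev, hui, hvi]
  have huw : ∀ m : ℤ, u * w ^ m * u⁻¹ = w ^ (-m) := by
    intro m
    rw [← conj_zpow, zpow_neg, ← inv_zpow]
    congr 1
    rw [hwi, hw, hui, ← mul_assoc, hu2, one_mul]
  have hwv : ∀ k : ℤ, w ^ k * v = w ^ (k - 1) * u := by
    intro k
    rw [zpow_sub_one, hwi, mul_assoc, mul_assoc, hu2, mul_one]
  have huv : u * v = w := hw.symm
  have hall : ∀ g : G, (∃ k : ℤ, g = w ^ k) ∨ ∃ k : ℤ, g = w ^ k * u := by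
    intro g
    have hg : g ∈ Subgroup.closure ({u, v} : Set G) := by rw [h1]; trivial
    have key : ∀ g t : G, ((∃ k : ℤ, g = w ^ k) ∨ ∃ k : ℤ, g = w ^ k * u) → t ∈ ({u, v} : Set G) →
        ((∃ k : ℤ, g * t = w ^ k) ∨ ∃ k : ℤ, g * t = w ^ k * u) := by
      rintro g t (⟨k, rfl⟩ | ⟨k, rfl⟩) (rfl | rfl)
      · exact Or.inr ⟨k, rfl⟩
      · exact Or.inr ⟨k - 1, hwv k⟩
      · exact Or.inl ⟨k, by rw [mul_assoc, hu2, mul_one]⟩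
      · exact Or.inl ⟨k + 1, by rw [mul_assoc, huv, zpow_add_one]⟩
    induction hg using Subgroup.closure_induction_right with
    | one => exact Or.inl ⟨0, by simp⟩
    | mul_right g _ t ht ih => exact key g t ih ht
    | mul_inv_cancel g _ t ht ih =>
      have : t⁻¹ = t := by
        rcases ht with rfl | rfl
        · exact hui
        · exact hvi
      rw [this]
      exact key g t ih ht
  have hconj : ∀ m : ℤ, w ^ m * u * (w ^ m)⁻¹ = w ^ (2 * m) * u := by
    intro m
    have := huw (-m)
    rw [neg_neg] at this
    rw [two_mul, zpow_add, ← zpow_neg]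
    calc w ^ m * u * w ^ (-m) = w ^ m * (u * w ^ (-m) * u⁻¹) * u := by group
      _ = _ := by rw [this]
  have hrot : ∀ t ∈ ({a, b, c} : Set G), t ∈ Subgroup.zpowers w := by
    intro t ht
    rcases hall t with ⟨k, hk⟩ | ⟨k, hk⟩
    · exact ⟨k, hk.symm⟩
    · exfalso
      rcases Int.even_or_odd' k with ⟨m, rfl | rfl⟩
      · apply hu1
        rw [← hconj] at hk
        simpa using hu t ht (w ^ m)⁻¹ 1 1 (by rw [hk]; group)
      · apply hv1
        have hk' : t = (w ^ m * u) * v * (w ^ m * u)⁻¹ := by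
          rw [hk]
          have e1 := hconj m
          have e2 := huw (-m)
          rw [neg_neg] at e2
          have : (w ^ m * u) * v * (w ^ m * u)⁻¹ = w ^ m * (u * v) * u⁻¹ * (w ^ m)⁻¹ := by group
          rw [this, huv, hui]
          have e3 : u * (w ^ m)⁻¹ = w ^ m * u := by
            rw [← zpow_neg, ← e2]; group
          rw [mul_assoc _ u, e3]
          rw [two_mul]
          group
        simpa using hv t ht (w ^ m * u)⁻¹ 1 1 (by rw [hk']; group)
  have htop : Subgroup.zpowers w = ⊤ := by
    rw [eq_top_iff, ← h2, Subgroup.closure_le]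
    exact hrot
  obtain ⟨i, hi⟩ : u ∈ Subgroup.zpowers w := by rw [htop]; trivial
  simp only at hi
  have hw2 : w * w = 1 := by
    have := huw 1
    rw [← hi, zpow_one, zpow_neg, zpow_one] at this
    rw [mul_eq_one_iff_eq_inv, ← this]
    group
  have hw2' : w ^ (2 : ℤ) = 1 := by rw [zpow_two, hw2]
  rcases Int.even_or_odd' i with ⟨m, rfl | rfl⟩
  · rw [zpow_mul, hw2', one_zpow] at hi
    exact hu1 hi.symm
  · rw [zpow_add, zpow_mul, hw2', one_zpow, one_mul, zpow_one, hw] at hi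
    exact hv1 (by simpa using hi)

end BeauvilleAux

namespace BeauvilleAux

/-- The wreath-type extension of `G` by functions `G → ZMod p`. -/
@[ext]
structure Ext (p : ℕ) (G : Type) where
  /-- the function part -/
  fn : G → ZMod p
  /-- the group part -/
  el : G

namespace Ext

variable {p : ℕ} {G : Type} [Group G]

instance : Mul (Ext p G) := ⟨fun s t => ⟨fun h => s.fn h + t.fn (h * s.el), s.el * t.el⟩⟩
instance : One (Ext p G) := ⟨⟨fun _ => 0, 1⟩⟩
instance : Inv (Ext p G) := ⟨fun s => ⟨fun h => - s.fn (h * s.el⁻¹), s.el⁻¹⟩⟩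

theorem mul_fn (s t : Ext p G) (h : G) : (s * t).fn h = s.fn h + t.fn (h * s.el) := rfl
theorem mul_el (s t : Ext p G) : (s * t).el = s.el * t.el := rfl
theorem one_fn (h : G) : (1 : Ext p G).fn h = 0 := rfl
theorem one_el : (1 : Ext p G).el = 1 := rfl
theorem inv_fn (s : Ext p G) (h : G) : (s⁻¹).fn h = - s.fn (h * s.el⁻¹) := rfl
theorem inv_el (s : Ext p G) : (s⁻¹).el = s.el⁻¹ := rfl

instance : Group (Ext p G) := Group.ofLeftAxioms
  (by
    intro s t u
    ext h
    · simp only [mul_fn, mul_el, add_assoc, mul_assoc]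
    · simp only [mul_el, mul_assoc])
  (by
    intro s
    ext h
    · simp only [mul_fn, one_fn, one_el, zero_add, mul_one]
    · simp only [mul_el, one_el, one_mul])
  (by
    intro s
    ext h
    · simp only [mul_fn, inv_fn, inv_el, one_fn, neg_add_cancel]
    · simp only [mul_el, inv_el, one_el, inv_mul_cancel])

/-- The projection to `G`. -/
def proj : Ext p G →* G where
  toFun := Ext.el
  map_one' := rfl
  map_mul' _ _ := rfl

theorem pow_el (s : Ext p G) (i : ℕ) : (s ^ i).el = s.el ^ i := map_pow (proj (p := p)) s i

theorem pow_fn (s : Ext p G) (i : ℕ) (h : G) :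
    (s ^ i).fn h = ∑ k ∈ Finset.range i, s.fn (h * s.el ^ k) := by
  induction i with
  | zero => simp [one_fn]
  | succ i ih => rw [pow_succ, mul_fn, ih, Finset.sum_range_succ, pow_el]

/-- The underlying set is a product. -/
def equivProd : Ext p G ≃ (G → ZMod p) × G where
  toFun s := (s.fn, s.el)
  invFun q := ⟨q.1, q.2⟩
  left_inv _ := rfl
  right_inv _ := rfl

theorem finite [Fact p.Prime] [Finite G] : Finite (Ext p G) := Finite.of_equiv _ equivProd.symm

theorem isPGroup [Fact p.Prime] [Finite G] (hG : IsPGroup p G) : IsPGroup p (Ext p G) := by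
  obtain ⟨n, hn⟩ := IsPGroup.iff_card.1 hG
  refine IsPGroup.of_card (n := Nat.card G + n) ?_
  rw [Nat.card_congr equivProd, Nat.card_prod, Nat.card_fun, Nat.card_zmod, hn, pow_add]

end Ext

theorem sum_coset {K G : Type*} [AddCommMonoid K] [Group G] [Fintype G] (x : G) (w : G → K) (h : G)
    [Fintype (Subgroup.zpowers x)] :
    ∑ k ∈ Finset.range (orderOf x), w (h * x ^ k) =
      ∑ s : Subgroup.zpowers x, w ((h : G ⧸ Subgroup.zpowers x).out * s) := by
  have hm : (h : G ⧸ Subgroup.zpowers x).out⁻¹ * h ∈ Subgroup.zpowers x := by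
    rw [← QuotientGroup.eq]
    exact Quotient.out_eq' _
  obtain ⟨t, ht⟩ : ∃ t : Subgroup.zpowers x, (t : G) = (h : G ⧸ Subgroup.zpowers x).out⁻¹ * h :=
    ⟨⟨_, hm⟩, rfl⟩
  rw [← Equiv.sum_comp (Equiv.mulLeft t)]
  rw [Finset.sum_range, ← Equiv.sum_comp (finEquivZPowers (isOfFinOrder_of_finite x))]
  refine Finset.sum_congr rfl fun k _ => ?_
  congr 1
  simp only [Equiv.coe_mulLeft, Subgroup.coe_mul, ht, finEquivZPowers_apply]
  group

theorem exists_voltage {p : ℕ} (hp : p.Prime) {G : Type} [Group G] [Finite G] (x y t : G)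
    (hcard : Nat.card (G ⧸ Subgroup.zpowers x) + Nat.card (G ⧸ Subgroup.zpowers y) +
      Nat.card (G ⧸ Subgroup.zpowers t) ≤ Nat.card G) :
    ∃ w₁ w₂ : G → ZMod p,
      (∀ h, ∑ k ∈ Finset.range (orderOf x), w₁ (h * x ^ k) = 0) ∧
      (∀ h, ∑ k ∈ Finset.range (orderOf y), w₂ (h * y ^ k) = 0) ∧
      (∀ h, ∑ k ∈ Finset.range (orderOf t), (w₁ (h * t ^ k) + w₂ (h * t ^ k * x)) = 0) ∧
      ¬ ∃ f : G → ZMod p, (∀ h, f (h * x) = f h + w₁ h) ∧ (∀ h, f (h * y) = f h + w₂ h) := by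
  classical
  have : Fact p.Prime := ⟨hp⟩
  haveI := Fintype.ofFinite G
  let C : ∀ u : G, (G → (ZMod p)) →ₗ[(ZMod p)] (G ⧸ Subgroup.zpowers u → (ZMod p)) := fun u =>
    { toFun := fun w q => ∑ s : Subgroup.zpowers u, w (q.out * s)
      map_add' := by
        intro v w
        ext q
        simp [Finset.sum_add_distrib]
      map_smul' := by
        intro r w
        ext q
        simp [Finset.mul_sum] }
  let T : ((G → ZMod p) × (G → ZMod p)) →ₗ[(ZMod p)] (G → (ZMod p)) :=
    { toFun := fun v h => v.1 h + v.2 (h * x)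
      map_add' := by
        intro v w
        ext q
        simp only [Prod.fst_add, Prod.snd_add, Pi.add_apply]
        ring
      map_smul' := by
        intro r w
        ext q
        simp only [Prod.smul_fst, Prod.smul_snd, Pi.smul_apply, smul_eq_mul, RingHom.id_apply]
        ring }
  let P : (G → (ZMod p)) →ₗ[(ZMod p)] ((G → ZMod p) × (G → ZMod p)) :=
    { toFun := fun f => (fun h => f (h * x) - f h, fun h => f (h * y) - f h)
      map_add' := by
        intro v w
        ext q <;> simp <;> ring
      map_smul' := by
        intro r w
        ext q <;> simp <;> ring }
  let L : ((G → ZMod p) × (G → ZMod p)) →ₗ[(ZMod p)] (G ⧸ Subgroup.zpowers x → (ZMod p)) × (G ⧸ Subgroup.zpowers y → (ZMod p)) ×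
      (G ⧸ Subgroup.zpowers t → (ZMod p)) :=
    LinearMap.prod (C x ∘ₗ LinearMap.fst (ZMod p) _ _)
      (LinearMap.prod (C y ∘ₗ LinearMap.snd (ZMod p) _ _) (C t ∘ₗ T))
  have hL := L.finrank_range_add_finrank_ker
  have hL2 := Submodule.finrank_le (LinearMap.range L)
  have hP := P.finrank_range_add_finrank_ker
  have hV : Module.finrank (ZMod p) ((G → ZMod p) × (G → ZMod p)) = Nat.card G + Nat.card G := by
    simp [Nat.card_eq_fintype_card]
  have hW : Module.finrank (ZMod p) (G → (ZMod p)) = Nat.card G := by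
    simp [Nat.card_eq_fintype_card]
  have hT : Module.finrank (ZMod p) ((G ⧸ Subgroup.zpowers x → (ZMod p)) × (G ⧸ Subgroup.zpowers y → (ZMod p)) ×
      (G ⧸ Subgroup.zpowers t → (ZMod p))) = Nat.card (G ⧸ Subgroup.zpowers x) +
      (Nat.card (G ⧸ Subgroup.zpowers y) + Nat.card (G ⧸ Subgroup.zpowers t)) := by
    simp only [Module.finrank_prod, Module.finrank_fintype_fun_eq_card, Nat.card_eq_fintype_card]
  have hker : 0 < Module.finrank (ZMod p) (LinearMap.ker P) := by
    rw [Module.finrank_pos_iff]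
    refine ⟨⟨⟨fun _ => 1, ?_⟩, 0, ?_⟩⟩
    · rw [LinearMap.mem_ker]
      ext q <;> simp [P]
    · intro h
      have := congrFun (congrArg Subtype.val h) 1
      simp at this
  have hnle : ¬ LinearMap.ker L ≤ LinearMap.range P := by
    intro hle
    have := Submodule.finrank_mono hle
    omega
  obtain ⟨v, hv, hvP⟩ := SetLike.not_le_iff_exists.1 hnle
  rw [LinearMap.mem_ker] at hv
  have hv1 : C x v.1 = 0 := congrArg Prod.fst hv
  have hv2 : C y v.2 = 0 := congrArg (fun r => r.2.1) hv
  have hv3 : C t (T v) = 0 := congrArg (fun r => r.2.2) hv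
  refine ⟨v.1, v.2, ?_, ?_, ?_, ?_⟩
  · intro h
    rw [sum_coset]
    exact congrFun hv1 _
  · intro h
    rw [sum_coset]
    exact congrFun hv2 _
  · intro h
    have := sum_coset t (T v) h
    exact this.trans (congrFun hv3 _)
  · rintro ⟨f, hf1, hf2⟩
    apply hvP
    refine ⟨f, ?_⟩
    ext h
    · simp [P, hf1]
    · simp [P, hf2]

theorem exists_cover {p : ℕ} (hp : p.Prime) {G : Type} [Group G] [Finite G] (hG : IsPGroup p G)
    (x y : G) (hc : Subgroup.closure {x, y} = ⊤)
    (hcard : Nat.card (G ⧸ Subgroup.zpowers x) + Nat.card (G ⧸ Subgroup.zpowers y) +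
      Nat.card (G ⧸ Subgroup.zpowers (x * y)) ≤ Nat.card G) :
    ∃ (H : Type) (_ : Group H) (_ : Finite H), IsPGroup p H ∧ ∃ φ : H →* G,
      Function.Surjective φ ∧ ¬ Function.Injective φ ∧ ∃ x' y' : H,
        Subgroup.closure {x', y'} = ⊤ ∧ φ x' = x ∧ φ y' = y ∧
        orderOf x' = orderOf x ∧ orderOf y' = orderOf y ∧ orderOf (x' * y') = orderOf (x * y) := by
  have : Fact p.Prime := ⟨hp⟩
  obtain ⟨w₁, w₂, h1, h2, h3, hno⟩ := exists_voltage hp x y (x * y) hcard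
  have : Finite (Ext p G) := Ext.finite
  let X : Ext p G := ⟨w₁, x⟩
  let Y : Ext p G := ⟨w₂, y⟩
  let S : Subgroup (Ext p G) := Subgroup.closure {X, Y}
  have hX : X ∈ S := Subgroup.subset_closure (by simp)
  have hY : Y ∈ S := Subgroup.subset_closure (by simp)
  let X' : S := ⟨X, hX⟩
  let Y' : S := ⟨Y, hY⟩
  let φ : S →* G := Ext.proj.comp S.subtype
  have hord : ∀ s : S, (s : Ext p G) ^ orderOf (φ s) = 1 → orderOf s = orderOf (φ s) := by
    intro s hs
    apply Nat.dvd_antisymm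
    · apply orderOf_dvd_of_pow_eq_one
      apply Subtype.ext
      simpa using hs
    · exact orderOf_map_dvd φ s
  have hgen : Subgroup.closure {X', Y'} = (⊤ : Subgroup S) := by
    have := Subgroup.closure_closure_coe_preimage (k := ({X, Y} : Set (Ext p G)))
    rw [← this]
    congr 1
    ext s
    simp [X', Y', Subtype.ext_iff]
  have hsurj : Function.Surjective φ := by
    rw [← MonoidHom.range_eq_top, eq_top_iff, ← hc, Subgroup.closure_le]
    rintro g (rfl | rfl)
    · exact ⟨X', rfl⟩
    · exact ⟨Y', rfl⟩
  refine ⟨S, inferInstance, inferInstance, (Ext.isPGroup hG).to_subgroup S, φ, hsurj, ?_,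
    X', Y', hgen, rfl, rfl, ?_, ?_, ?_⟩
  · intro hinj
    apply hno
    choose d hd using hsurj
    have key : ∀ (h : G) (s : S), d (h * φ s) = d h * s := by
      intro h s
      apply hinj
      rw [hd, map_mul, hd]
    have hel : ∀ h, (d h : Ext p G).el = h := hd
    refine ⟨fun g => (d g : Ext p G).fn 1, ?_, ?_⟩
    · intro h
      have := congrArg (fun s : S => (s : Ext p G).fn 1) (key h X')
      simp only [Subgroup.coe_mul, Ext.mul_fn, hel, one_mul] at this
      exact this
    · intro h
      have := congrArg (fun s : S => (s : Ext p G).fn 1) (key h Y')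
      simp only [Subgroup.coe_mul, Ext.mul_fn, hel, one_mul] at this
      exact this
  · apply hord
    ext h
    · rw [Ext.pow_fn]; exact h1 h
    · rw [Ext.pow_el]; exact pow_orderOf_eq_one x
  · apply hord
    ext h
    · rw [Ext.pow_fn]; exact h2 h
    · rw [Ext.pow_el]; exact pow_orderOf_eq_one y
  · apply hord (X' * Y')
    ext h
    · rw [Ext.pow_fn]; exact h3 h
    · rw [Ext.pow_el]; exact pow_orderOf_eq_one (x * y)

theorem closure_pair {G : Type*} [Group G] {x y z : G} (h : x * y * z = 1) :
    Subgroup.closure {x, y, z} = Subgroup.closure {x, y} := by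
  apply le_antisymm
  · rw [Subgroup.closure_le]
    have hx : x ∈ Subgroup.closure ({x, y} : Set G) := Subgroup.subset_closure (by simp)
    have hy : y ∈ Subgroup.closure ({x, y} : Set G) := Subgroup.subset_closure (by simp)
    rintro g (rfl | rfl | rfl)
    · exact hx
    · exact hy
    · rw [← inv_eq_of_mul_eq_one_right h]
      exact inv_mem (mul_mem hx hy)
  · apply Subgroup.closure_mono
    intro g hg
    rcases hg with rfl | rfl <;> simp

theorem order_ne_one {G : Type*} [Group G] [Nontrivial G] {x y z a b c : G}
    (hB : IsBeauvilleStructure x y z a b c) : x ≠ 1 := by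
  obtain ⟨e1, -, h1, h2, h⟩ := hB
  rintro rfl
  apply no_cyclic h2 (h y (by simp))
  rw [closure_pair e1] at h1
  rw [eq_top_iff, ← h1, Subgroup.closure_le]
  rintro g (rfl | rfl)
  · exact one_mem _
  · exact Subgroup.mem_zpowers _

theorem not_both_two {G : Type*} [Group G] [Nontrivial G] {x y z a b c : G}
    (hB : IsBeauvilleStructure x y z a b c) (hx1 : x ≠ 1) (hy1 : y ≠ 1) :
    ¬ (orderOf x = 2 ∧ orderOf y = 2) := by
  rintro ⟨hx, hy⟩
  obtain ⟨e1, -, h1, h2, h⟩ := hB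
  rw [closure_pair e1] at h1
  refine no_dihedral ?_ ?_ hx1 hy1 h1 h2 (h x (by simp)) (h y (by simp))
  · rw [← pow_two, ← hx, pow_orderOf_eq_one]
  · rw [← pow_two, ← hy, pow_orderOf_eq_one]

theorem rotate {G : Type*} [Group G] {x y z a b c : G}
    (hB : IsBeauvilleStructure x y z a b c) : IsBeauvilleStructure y z x a b c := by
  obtain ⟨e1, e2, h1, h2, h⟩ := hB
  have hs : ({y, z, x} : Set G) = {x, y, z} := by
    ext g; simp; tauto
  refine ⟨?_, e2, ?_, h2, ?_⟩
  · rw [mul_assoc] at e1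
    rw [mul_eq_one_iff_eq_inv] at e1
    rw [e1, mul_inv_cancel]
  · rw [hs, h1]
  · rw [hs]; exact h

theorem index_sum {p : ℕ} (hp : p.Prime) {G : Type*} [Group G] [Finite G] [Nontrivial G]
    (hG : IsPGroup p G) {x y z a b c : G} (hB : IsBeauvilleStructure x y z a b c) :
    Nat.card (G ⧸ Subgroup.zpowers x) + Nat.card (G ⧸ Subgroup.zpowers y) +
      Nat.card (G ⧸ Subgroup.zpowers z) ≤ Nat.card G := by
  have : Fact p.Prime := ⟨hp⟩
  have hx1 := order_ne_one hB
  have hy1 := order_ne_one (rotate hB)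
  have hz1 := order_ne_one (rotate (rotate hB))
  have hxy := not_both_two hB hx1 hy1
  have hyz := not_both_two (rotate hB) hy1 hz1
  have hzx := not_both_two (rotate (rotate hB)) hz1 hx1
  have hc : ∀ g : G, Nat.card G = Nat.card (G ⧸ Subgroup.zpowers g) * orderOf g := by
    intro g
    rw [← Nat.card_zpowers]
    exact Subgroup.card_eq_card_quotient_mul_card_subgroup _
  have hord : ∀ g : G, g ≠ 1 → (3 ≤ p ∧ 3 ≤ orderOf g) ∨ (p = 2 ∧ (orderOf g = 2 ∨
      4 ≤ orderOf g)) := by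
    intro g hg
    obtain ⟨k, hk⟩ := IsPGroup.iff_orderOf.1 hG g
    have hk0 : k ≠ 0 := by
      rintro rfl
      rw [pow_zero, orderOf_eq_one_iff] at hk
      exact hg hk
    have h2 := hp.two_le
    rcases Nat.lt_or_ge 2 p with h | h
    · left
      refine ⟨h, ?_⟩
      rw [hk]
      exact h.trans_le (Nat.le_self_pow hk0 p)
    · right
      have hp2 : p = 2 := le_antisymm h h2
      refine ⟨hp2, ?_⟩
      subst hp2
      rcases Nat.lt_or_ge 1 k with h' | h'
      · right
        rw [hk]
        exact Nat.pow_le_pow_right (n := 2) (by norm_num) h'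
      · left
        have : k = 1 := by omega
        rw [hk, this, pow_one]
  have hx := hord x hx1
  have hy := hord y hy1
  have hz := hord z hz1
  have cx := hc x
  have cy := hc y
  have cz := hc z
  have b2 : ∀ n : ℕ, ∀ g : G, n ≤ orderOf g → n * Nat.card (G ⧸ Subgroup.zpowers g) ≤ Nat.card G := by
    intro n g hn
    rw [hc g, mul_comm]
    exact Nat.mul_le_mul_left _ hn
  have tri : ∀ g : G, (3 ≤ p ∧ 3 * Nat.card (G ⧸ Subgroup.zpowers g) ≤ Nat.card G) ∨
      (p = 2 ∧ ((orderOf g = 2 ∧ 2 * Nat.card (G ⧸ Subgroup.zpowers g) ≤ Nat.card G) ∨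
        4 * Nat.card (G ⧸ Subgroup.zpowers g) ≤ Nat.card G)) ∨ g = 1 := by
    intro g
    by_cases hg : g = 1
    · exact Or.inr (Or.inr hg)
    rcases hord g hg with ⟨h, h'⟩ | ⟨h, h' | h'⟩
    · exact Or.inl ⟨h, b2 3 g h'⟩
    · exact Or.inr (Or.inl ⟨h, Or.inl ⟨h', b2 2 g h'.ge⟩⟩)
    · exact Or.inr (Or.inl ⟨h, Or.inr (b2 4 g h')⟩)
  have tx := tri x
  have ty := tri y
  have tz := tri z
  simp only [hx1, hy1, hz1, or_false] at tx ty tz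
  clear hx hy hz cx cy cz b2 tri hord hc
  omega

theorem step {p : ℕ} (hp : p.Prime)
    {G : Type} [Group G] [Finite G] [Nontrivial G] (hG : IsPGroup p G)
    (x y z a b c : G) (hB : IsBeauvilleStructure x y z a b c) :
    ∃ (H : Type) (_ : Group H) (_ : Finite H), IsPGroup p H ∧ Nat.card G < Nat.card H ∧
      ∃ φ : H →* G, Function.Surjective φ ∧
        ∃ x' y' z' a' b' c' : H, IsBeauvilleStructure x' y' z' a' b' c' ∧
          φ x' = x ∧ φ y' = y ∧ φ z' = z ∧ φ a' = a ∧ φ b' = b ∧ φ c' = c ∧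
          orderOf x' = orderOf x ∧ orderOf y' = orderOf y ∧ orderOf z' = orderOf z := by
  have hidx := index_sum hp hG hB
  obtain ⟨M₁, M₂, hM₁, hM₂, hne⟩ := two_coatoms hB
  obtain ⟨e1, e2, h1, h2, h⟩ := hB
  have hz : z = (x * y)⁻¹ := (inv_eq_of_mul_eq_one_right e1).symm
  have hcc : c = (a * b)⁻¹ := (inv_eq_of_mul_eq_one_right e2).symm
  have h1' := h1
  rw [closure_pair e1] at h1'
  have h2' := h2
  rw [closure_pair e2] at h2'
  rw [hz, Subgroup.zpowers_inv] at hidx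
  obtain ⟨H, _, _, hH, φ, hs, hni, x', y', hgen, hx, hy, ox, oy, oz⟩ :=
    exists_cover hp hG x y h1' hidx
  obtain ⟨a', ha⟩ := hs a
  obtain ⟨b', hb⟩ := hs b
  have hz' : φ (x' * y')⁻¹ = z := by rw [map_inv, map_mul, hx, hy, hz]
  have hc' : φ (a' * b')⁻¹ = c := by rw [map_inv, map_mul, ha, hb, hcc]
  have oz' : orderOf (x' * y')⁻¹ = orderOf z := by rw [hz, orderOf_inv, orderOf_inv, oz]
  have e1' : x' * y' * (x' * y')⁻¹ = 1 := mul_inv_cancel _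
  have e2' : a' * b' * (a' * b')⁻¹ = 1 := mul_inv_cancel _
  refine ⟨H, inferInstance, inferInstance, hH, ?_, φ, hs, x', y', (x' * y')⁻¹, a', b',
    (a' * b')⁻¹, ⟨e1', e2', ?_, ?_, ?_⟩, hx, hy, hz', ha, hb, hc', ox, oy, oz'⟩
  · refine lt_of_le_of_ne (Nat.card_le_card_of_surjective φ hs) ?_
    intro heq
    exact hni ((Nat.bijective_iff_surjective_and_card φ).2 ⟨hs, heq.symm⟩).1
  · rw [closure_pair e1', hgen]
  · rw [closure_pair e2']
    apply gen_lift hp hG hH φ hgen hs hM₁ hM₂ hne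
    rw [Set.image_pair, ha, hb, h2']
  · intro u hu v hv g i j huv
    have hu' : φ u ∈ ({x, y, z} : Set G) ∧ orderOf u = orderOf (φ u) := by
      rcases hu with rfl | rfl | rfl
      · rw [hx]; exact ⟨by simp, ox⟩
      · rw [hy]; exact ⟨by simp, oy⟩
      · rw [hz']; exact ⟨by simp, oz'⟩
    have hv' : φ v ∈ ({a, b, c} : Set G) := by
      rcases hv with rfl | rfl | rfl
      · rw [ha]; simp
      · rw [hb]; simp
      · rw [hc']; simp
    have := h _ hu'.1 _ hv' (φ g) i j (by
      rw [← map_zpow, huv, map_mul, map_mul, map_inv, map_zpow])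
    rw [← orderOf_dvd_iff_zpow_eq_one] at this ⊢
    rwa [hu'.2]

end BeauvilleAux

/-- Every finite `p`-group with a Beauville structure admits arbitrarily large
finite `p`-group covers with compatible Beauville structures preserving the signature of the
first half. -/
theorem exists_large_cover_with_beauville
    {p : ℕ} (hp : p.Prime)
    {G : Type} [Group G] [Finite G] [Nontrivial G] (hG : IsPGroup p G)
    (x y z a b c : G) (hB : IsBeauvilleStructure x y z a b c) (N : ℕ) :
    ∃ (H : Type) (_ : Group H) (_ : Finite H), IsPGroup p H ∧ N ≤ Nat.card H ∧
      ∃ φ : H →* G, Function.Surjective φ ∧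
        ∃ x' y' z' a' b' c' : H, IsBeauvilleStructure x' y' z' a' b' c' ∧
          φ x' = x ∧ φ y' = y ∧ φ z' = z ∧ φ a' = a ∧ φ b' = b ∧ φ c' = c ∧
          orderOf x' = orderOf x ∧ orderOf y' = orderOf y ∧ orderOf z' = orderOf z := by
  induction N with
  | zero =>
    exact ⟨G, inferInstance, inferInstance, hG, Nat.zero_le _, MonoidHom.id G,
      Function.surjective_id, x, y, z, a, b, c, hB, rfl, rfl, rfl, rfl, rfl, rfl, rfl, rfl, rfl⟩
  | succ N ih =>
    obtain ⟨H, _, _, hH, hN, φ, hs, x', y', z', a', b', c', hB', hx, hy, hz, ha, hb, hc,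
      ox, oy, oz⟩ := ih
    have : Nontrivial H := hs.nontrivial
    obtain ⟨H', _, _, hH', hN', ψ, hs', x2, y2, z2, a2, b2, c2, hB2, hx2, hy2, hz2, ha2, hb2, hc2,
      ox2, oy2, oz2⟩ := BeauvilleAux.step hp hH x' y' z' a' b' c' hB'
    refine ⟨H', inferInstance, inferInstance, hH', by omega, φ.comp ψ, hs.comp hs',
      x2, y2, z2, a2, b2, c2, hB2, ?_, ?_, ?_, ?_, ?_, ?_, ox2.trans ox, oy2.trans oy,
      oz2.trans oz⟩
    · rw [MonoidHom.comp_apply, hx2, hx]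
    · rw [MonoidHom.comp_apply, hy2, hy]
    · rw [MonoidHom.comp_apply, hz2, hz]
    · rw [MonoidHom.comp_apply, ha2, ha]
    · rw [MonoidHom.comp_apply, hb2, hb]
    · rw [MonoidHom.comp_apply, hc2, hc]
end

section
/- For every prime p and every natural number N there exists a finite p-group G with Nat.card G ≥ N that admits an unmixed Beauville structure. In particular, for every prime p there are infinitely many (isomorphism classes of) finite p-groups with an unmixed Beauville structure. -/
/-!
Construction.  Let `n = p ^ k ≥ 8` and let `W = ℤ/n ≀ ℤ/n`.  Let `t` be the generator of the top
group, and `d = δ₀ - δ₁` in the base group.  We take the subgroup of `W × W × W` generated by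
`X = (d, t, dt)` and `Y = (t, d, t⁻¹)`, so that `XY = (dt, td, d)`.
The second triple is given by `A = X y²[X,Y]y⁻²`, `B = Y x³[X,Y]x⁻³`.
-/

/-- The wreath product `ℤ/n ≀ ℤ/n`. -/
@[ext]
structure BW (n : ℕ) where
  f : ZMod n → ZMod n
  q : ZMod n

namespace BW

variable {n : ℕ}

instance : Mul (BW n) := ⟨fun a b => ⟨fun x => a.f x + b.f (x - a.q), a.q + b.q⟩⟩
instance : One (BW n) := ⟨⟨fun _ => 0, 0⟩⟩
instance : Inv (BW n) := ⟨fun a => ⟨fun x => -a.f (x + a.q), -a.q⟩⟩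

@[simp] lemma mul_f (a b : BW n) (x : ZMod n) : (a * b).f x = a.f x + b.f (x - a.q) := rfl
@[simp] lemma mul_q (a b : BW n) : (a * b).q = a.q + b.q := rfl
@[simp] lemma one_f (x : ZMod n) : (1 : BW n).f x = 0 := rfl
@[simp] lemma one_q : (1 : BW n).q = 0 := rfl
@[simp] lemma inv_f (a : BW n) (x : ZMod n) : (a⁻¹).f x = -a.f (x + a.q) := rfl
@[simp] lemma inv_q (a : BW n) : (a⁻¹).q = -a.q := rfl

instance : Group (BW n) where
  mul_assoc a b c := by
    ext x
    · simp [add_assoc, sub_sub]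
    · simp [add_assoc]
  one_mul a := by ext <;> simp
  mul_one a := by ext <;> simp
  inv_mul_cancel a := by ext <;> simp

/-- The underlying product. -/
def equivProd (n : ℕ) : BW n ≃ (ZMod n → ZMod n) × ZMod n where
  toFun a := (a.f, a.q)
  invFun a := ⟨a.1, a.2⟩
  left_inv _ := rfl
  right_inv _ := rfl

instance [NeZero n] : Finite (BW n) := Finite.of_equiv _ (equivProd n).symm

lemma card [NeZero n] : Nat.card (BW n) = n ^ n * n := by
  rw [Nat.card_congr (equivProd n), Nat.card_prod, Nat.card_fun, Nat.card_zmod]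

/-- Projection to the top group. -/
def top (n : ℕ) : BW n →* Multiplicative (ZMod n) where
  toFun a := Multiplicative.ofAdd a.q
  map_one' := rfl
  map_mul' _ _ := rfl

lemma zpow_q (a : BW n) (i : ℤ) : (a ^ i).q = i * a.q := by
  have h := map_zpow (top n) a i
  have h2 := congrArg Multiplicative.toAdd h
  simpa [top] using h2

/-- Inclusion of the base group. -/
def base (n : ℕ) : Multiplicative (ZMod n → ZMod n) →* BW n where
  toFun f := ⟨f.toAdd, 0⟩
  map_one' := rfl
  map_mul' a b := by ext <;> simp

lemma zpow_f (a : BW n) (ha : a.q = 0) (i : ℤ) (x : ZMod n) : (a ^ i).f x = i * a.f x := by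
  have e : a = base n (Multiplicative.ofAdd a.f) := by ext <;> simp [base, ha]
  have h : a ^ i = base n (Multiplicative.ofAdd (i • a.f)) := by
    rw [ofAdd_zsmul, map_zpow, ← e]
  rw [h]
  simp [base]

/-- Inclusion of the top group. -/
def topInc (n : ℕ) : Multiplicative (ZMod n) →* BW n where
  toFun q := ⟨fun _ => 0, q.toAdd⟩
  map_one' := rfl
  map_mul' a b := by ext <;> simp

/-- The generator of the top group. -/
def t (n : ℕ) : BW n := ⟨fun _ => 0, 1⟩

/-- `δ₀`. -/
def e (n : ℕ) : BW n := ⟨fun x => if x = 0 then 1 else 0, 0⟩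

/-- `δ₀ - δ₁`. -/
def d (n : ℕ) : BW n := e n * t n * (e n)⁻¹ * (t n)⁻¹

lemma d_f (x : ZMod n) : (d n).f x = (if x = 0 then 1 else 0) - (if x - 1 = 0 then 1 else 0) := by
  simp [d, e, t, sub_eq_add_neg]

@[simp] lemma d_q : (d n).q = 0 := by simp [d, e, t]
@[simp] lemma t_q : (t n).q = 1 := rfl
@[simp] lemma t_f (x : ZMod n) : (t n).f x = 0 := rfl

lemma t_pow : (t n) ^ n = 1 := by
  have : t n = topInc n (Multiplicative.ofAdd 1) := rfl
  rw [this, ← map_pow, ← ofAdd_nsmul]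
  simp

lemma d_pow : (d n) ^ n = 1 := by
  ext x
  · have := zpow_f (d n) d_q (n : ℤ) x
    simpa using this
  · have := zpow_q (d n) (n : ℤ)
    simpa using this

lemma dt_pow : (d n * t n) ^ n = 1 := by
  have : d n * t n = e n * t n * (e n)⁻¹ := by simp [d]
  rw [this, conj_pow, t_pow]; simp

lemma td_pow : (t n * d n) ^ n = 1 := by
  have : t n * d n = t n * (d n * t n) * (t n)⁻¹ := by simp [mul_assoc]
  rw [this, conj_pow, dt_pow]; simp

/-- If a base element has entries `±1` in three places then none of its nontrivial powers
is conjugate to a power of `d`. -/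
lemma base_conj (v g : BW n) (hv : v.q = 0) (r s w : ZMod n) (hrs : r ≠ s) (hrw : r ≠ w)
    (hsw : s ≠ w) (hr : v.f r = 1 ∨ v.f r = -1) (hs : v.f s = 1 ∨ v.f s = -1)
    (hw : v.f w = 1 ∨ v.f w = -1) (h1 : (1 : ZMod n) ≠ 0) (i j : ℤ)
    (h : (d n) ^ i = g * v ^ j * g⁻¹) : (i : ZMod n) = 0 := by
  have key : ∀ x, (i : ZMod n) * (d n).f (x + g.q) = j * v.f x := by
    intro x
    have := congrArg (fun a => a.f (x + g.q)) h
    simp only [mul_f, zpow_f _ d_q, zpow_f _ hv, mul_q, zpow_q, hv, inv_f] at this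
    rw [this]
    simp
  have fin : ∀ x, (v.f x = 1 ∨ v.f x = -1) → (d n).f (x + g.q) = 0 → (j : ZMod n) = 0 := by
    intro x hx hd
    have := key x
    rw [hd] at this
    rcases hx with hx | hx <;> rw [hx] at this <;> simpa using this.symm
  have hd : ∀ x : ZMod n, x ≠ 0 → x ≠ 1 → (d n).f x = 0 := by
    intro x hx hx1
    rw [d_f, if_neg hx, if_neg (sub_ne_zero.2 hx1)]; simp
  have hj : (j : ZMod n) = 0 := by
    by_cases a0 : r + g.q = 0 ∨ r + g.q = 1
    · by_cases b0 : s + g.q = 0 ∨ s + g.q = 1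
      · refine fin w hw (hd _ ?_ ?_)
        · intro hc; grind
        · intro hc; grind
      · push Not at b0
        exact fin s hs (hd _ b0.1 b0.2)
    · push Not at a0
      exact fin r hr (hd _ a0.1 a0.2)
  have := key (-g.q)
  rw [hj, d_f] at this
  simpa [h1] using this

end BW

/-- In a finite `p`-group, a subset generating modulo commutators generates. -/
lemma closure_eq_top_of_mod_comm {G : Type*} [Group G] [Finite G] {p : ℕ} [Fact p.Prime]
    (hG : IsPGroup p G) (S : Set G)
    (h : ∀ M : Subgroup G, commutator G ≤ M → S ⊆ M → M = ⊤) :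
    Subgroup.closure S = ⊤ := by
  by_contra hne
  obtain ⟨M, hM, hSM⟩ := (eq_top_or_exists_le_coatom (Subgroup.closure S)).resolve_left hne
  have := hG.isNilpotent
  have hn : M.Normal :=
    Subgroup.NormalizerCondition.normal_of_coatom M Group.normalizerCondition_of_isNilpotent hM
  refine hM.1 (h M ?_ ((Subgroup.closure_le _).1 hSM))
  have hQ : IsPGroup p (G ⧸ M) := hG.to_quotient M
  have hnt : Nontrivial (G ⧸ M) := by
    rw [← not_subsingleton_iff_nontrivial]
    intro hs
    exact hM.1 (QuotientGroup.subgroup_eq_top_of_subsingleton M hs)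
  have hc := hQ.center_nontrivial
  have hle : M ≤ (Subgroup.center (G ⧸ M)).comap (QuotientGroup.mk' M) := by
    intro x hx
    rw [Subgroup.mem_comap, (QuotientGroup.eq_one_iff x).2 hx |> fun e => (show QuotientGroup.mk' M x = 1 from e)]
    exact one_mem _
  rcases hM.le_iff.1 hle with h1 | h1
  · have hct : Subgroup.center (G ⧸ M) = ⊤ := by
      rw [eq_top_iff]
      intro y _
      obtain ⟨x, rfl⟩ := QuotientGroup.mk'_surjective M y
      have : x ∈ (Subgroup.center (G ⧸ M)).comap (QuotientGroup.mk' M) := by rw [h1]; trivial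
      exact this
    rw [commutator_def, Subgroup.commutator_le]
    intro a _ b _
    rw [← QuotientGroup.eq_one_iff]
    have hb : (b : G ⧸ M) ∈ Subgroup.center (G ⧸ M) := by rw [hct]; trivial
    have := Subgroup.mem_center_iff.1 hb (a : G ⧸ M)
    rw [commutatorElement_def]
    have e : ((a * b * a⁻¹ * b⁻¹ : G) : G ⧸ M) = (a : G ⧸ M) * b * (a : G ⧸ M)⁻¹ * (b : G ⧸ M)⁻¹ := rfl
    rw [e, this]; group
  · exfalso
    obtain ⟨⟨z, hz⟩, hz1⟩ := exists_ne (1 : Subgroup.center (G ⧸ M))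
    obtain ⟨x, rfl⟩ := QuotientGroup.mk'_surjective M z
    have : x ∈ M := by rw [← h1]; exact hz
    exact hz1 (Subtype.ext ((QuotientGroup.eq_one_iff x).2 this))

set_option maxHeartbeats 2000000 in
open BW in
/-- The Beauville structure, given three homomorphisms to the wreath product. -/
lemma beauville_main {G : Type} [Group G] [Finite G] {p : ℕ} [Fact p.Prime] (hG : IsPGroup p G)
    {n : ℕ} (hn : 8 ≤ n) (X Y : G) (hgen : Subgroup.closure {X, Y} = ⊤)
    (φ₁ φ₂ φ₃ : G →* BW n)
    (hinj : ∀ g, φ₁ g = 1 → φ₂ g = 1 → φ₃ g = 1 → g = 1)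
    (hX₁ : φ₁ X = d n) (hX₂ : φ₂ X = t n) (hX₃ : φ₃ X = d n * t n)
    (hY₁ : φ₁ Y = t n) (hY₂ : φ₂ Y = d n) (hY₃ : φ₃ Y = (t n)⁻¹) :
    ∃ x y z a b c : G, IsBeauvilleStructure x y z a b c := by
  obtain ⟨A, hA⟩ : ∃ A, A = X * (Y * (Y * (X * Y * X⁻¹ * Y⁻¹) * Y⁻¹) * Y⁻¹) := ⟨_, rfl⟩
  obtain ⟨B, hB⟩ : ∃ B, B = Y * (X * (X * (X * (X * Y * X⁻¹ * Y⁻¹) * X⁻¹) * X⁻¹) * X⁻¹) := ⟨_, rfl⟩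
  have num : ∀ m : ℕ, 0 < m → m < 8 → (m : ZMod n) ≠ 0 := by
    intro m hm hm8 h0
    rw [ZMod.natCast_eq_zero_iff] at h0
    exact absurd (Nat.le_of_dvd hm h0) (by omega)
  have n1 : (1 : ZMod n) ≠ 0 := by simpa using num 1 (by norm_num) (by norm_num)
  have n2 : (2 : ZMod n) ≠ 0 := by simpa using num 2 (by norm_num) (by norm_num)
  have n3 : (3 : ZMod n) ≠ 0 := by simpa using num 3 (by norm_num) (by norm_num)
  have n4 : (4 : ZMod n) ≠ 0 := by simpa using num 4 (by norm_num) (by norm_num)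
  have n5 : (5 : ZMod n) ≠ 0 := by simpa using num 5 (by norm_num) (by norm_num)
  have n6 : (6 : ZMod n) ≠ 0 := by simpa using num 6 (by norm_num) (by norm_num)
  have n7 : (7 : ZMod n) ≠ 0 := by simpa using num 7 (by norm_num) (by norm_num)
  have Xn : X ^ n = 1 := by
    apply hinj <;> rw [map_pow]
    · rw [hX₁, d_pow]
    · rw [hX₂, t_pow]
    · rw [hX₃, dt_pow]
  have Yn : Y ^ n = 1 := by
    apply hinj <;> rw [map_pow]
    · rw [hY₁, t_pow]
    · rw [hY₂, d_pow]
    · rw [hY₃, inv_pow, t_pow, inv_one]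
  have XYn : (X * Y) ^ n = 1 := by
    apply hinj <;> rw [map_pow, map_mul]
    · rw [hX₁, hY₁, dt_pow]
    · rw [hX₂, hY₂, td_pow]
    · rw [hX₃, hY₃, mul_inv_cancel_right, d_pow]
  have Zn : ((X * Y)⁻¹) ^ n = 1 := by rw [inv_pow, XYn, inv_one]
  have vanish : ∀ u : G, u ^ n = 1 → ∀ i : ℤ, (i : ZMod n) = 0 → u ^ i = 1 := by
    intro u hu i hi
    rw [ZMod.intCast_zmod_eq_zero_iff_dvd] at hi
    obtain ⟨k, rfl⟩ := hi
    rw [zpow_mul, zpow_natCast, hu, one_zpow]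
  have rel : ∀ (φ : G →* BW n) (u v g : G) (i j : ℤ), u ^ i = g * v ^ j * g⁻¹ →
      (i : ZMod n) * (φ u).q = j * (φ v).q := by
    intro φ u v g i j h
    have := congrArg (fun a => (φ a).q) h
    simp only [map_mul, map_zpow, map_inv, mul_q, inv_q, zpow_q] at this
    rw [this]; ring
  have qA₁ : (φ₁ A).q = 0 := by simp [hA, hX₁, hY₁]
  have qA₂ : (φ₂ A).q = 1 := by simp [hA, hX₂, hY₂]
  have qA₃ : (φ₃ A).q = 1 := by simp [hA, hX₃, hY₃]
  have qB₁ : (φ₁ B).q = 1 := by simp [hB, hX₁, hY₁]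
  have qB₂ : (φ₂ B).q = 0 := by simp [hB, hX₂, hY₂]
  have qB₃ : (φ₃ B).q = -1 := by simp [hB, hX₃, hY₃]
  refine ⟨X, Y, (X * Y)⁻¹, A, B, (A * B)⁻¹, by simp, by simp, ?_, ?_, ?_⟩
  · rw [eq_top_iff, ← hgen]
    apply Subgroup.closure_mono
    intro g hg
    rcases hg with rfl | rfl <;> simp
  · apply closure_eq_top_of_mod_comm hG
    intro M hM hS
    have hAM : A ∈ M := hS (by simp)
    have hBM : B ∈ M := hS (by simp)
    have hnorm : M.Normal := Subgroup.Normal.of_commutator_le G hM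
    have hc : X * Y * X⁻¹ * Y⁻¹ ∈ M := hM (Subgroup.commutator_mem_commutator
      (Subgroup.mem_top X) (Subgroup.mem_top Y))
    have hXM : X ∈ M := by
      rw [hA] at hAM
      exact (M.mul_mem_cancel_right (hnorm.conj_mem _ (hnorm.conj_mem _ hc _) _)).1 hAM
    have hYM : Y ∈ M := by
      rw [hB] at hBM
      exact (M.mul_mem_cancel_right
        (hnorm.conj_mem _ (hnorm.conj_mem _ (hnorm.conj_mem _ hc _) _) _)).1 hBM
    rw [eq_top_iff, ← hgen, Subgroup.closure_le]
    intro g hg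
    rcases hg with rfl | rfl <;> assumption
  · intro u hu v hv g i j h
    have r₁ := rel φ₁ u v g i j h
    have r₂ := rel φ₂ u v g i j h
    have r₃ := rel φ₃ u v g i j h
    rcases hu with rfl | rfl | rfl
    · refine vanish _ Xn i ?_
      rcases hv with rfl | rfl | rfl
      · have h' := congrArg φ₁ h
        simp only [map_mul, map_zpow, map_inv] at h'
        rw [hX₁] at h'
        have F : ∀ x, (φ₁ v).f x = (d n).f x + (d n).f (x - 2) - (d n).f (x - 3) := by
          intro x
          simp only [hA, map_mul, map_inv, hX₁, hY₁, mul_f, mul_q, inv_f, inv_q, t_f, t_q, d_q]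
          ring_nf
        refine base_conj (φ₁ v) (φ₁ g) qA₁ 0 2 4 ?_ ?_ ?_ ?_ ?_ ?_ n1 i j h'
        · grind
        · grind
        · grind
        · rw [F]; simp only [d_f]; grind
        · rw [F]; simp only [d_f]; grind
        · rw [F]; simp only [d_f]; grind
      · simpa [hX₁, hX₂, hX₃, qB₁, qB₂, qB₃] using r₂
      · simpa [hX₁, hX₂, hX₃, qA₃, qB₃] using r₃
    · refine vanish _ Yn i ?_
      rcases hv with rfl | rfl | rfl
      · simpa [hY₁, qA₁] using r₁
      · have h' := congrArg φ₂ h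
        simp only [map_mul, map_zpow, map_inv] at h'
        rw [hY₂] at h'
        have F : ∀ x, (φ₂ v).f x = (d n).f x + (d n).f (x - 4) - (d n).f (x - 3) := by
          intro x
          simp only [hB, map_mul, map_inv, hX₂, hY₂, mul_f, mul_q, inv_f, inv_q, t_f, t_q, d_q]
          ring_nf
        refine base_conj (φ₂ v) (φ₂ g) qB₂ 0 3 5 ?_ ?_ ?_ ?_ ?_ ?_ n1 i j h'
        · grind
        · grind
        · grind
        · rw [F]; simp only [d_f]; grind
        · rw [F]; simp only [d_f]; grind
        · rw [F]; simp only [d_f]; grind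
      · simpa [hY₃, qA₃, qB₃] using r₃
    · refine vanish _ Zn i ?_
      rcases hv with rfl | rfl | rfl
      · simpa [hX₁, hY₁, qA₁] using r₁
      · simpa [hX₂, hY₂, qB₂] using r₂
      · have h' := congrArg φ₃ h
        simp only [map_mul, map_zpow, map_inv] at h'
        rw [hX₃, hY₃, mul_inv_cancel_right, inv_zpow', ← map_mul, inv_zpow'] at h'
        have F : ∀ x, (φ₃ (A * B)).f x = (d n).f x + (d n).f (x + 1) - (d n).f (x + 2)
            + (d n).f (x - 3) - (d n).f (x - 2) := by
          intro x
          simp only [hA, hB, map_mul, map_inv, hX₃, hY₃, mul_f, mul_q, inv_f, inv_q, t_f, t_q, d_q]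
          ring_nf
        have := base_conj (φ₃ (A * B)) (φ₃ g) (by simp [qA₃, qB₃]) 1 2 4 ?_ ?_ ?_ ?_ ?_ ?_ n1 (-i) (-j) h'
        · simpa using this
        · grind
        · grind
        · grind
        · rw [F]; simp only [d_f]; grind
        · rw [F]; simp only [d_f]; grind
        · rw [F]; simp only [d_f]; grind

theorem exists_large_pGroup_with_beauville (p : ℕ) (hp : p.Prime) (N : ℕ) :
    ∃ (G : Type) (_ : Group G) (_ : Finite G), IsPGroup p G ∧ N ≤ Nat.card G ∧
      ∃ x y z a b c : G, IsBeauvilleStructure x y z a b c := by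
  have : Fact p.Prime := ⟨hp⟩
  obtain ⟨n, hn⟩ : ∃ n, n = p ^ (N + 3) := ⟨_, rfl⟩
  have hn8 : 8 ≤ n := by
    rw [hn]
    calc 8 = 2 ^ 3 := by norm_num
      _ ≤ p ^ 3 := Nat.pow_le_pow_left hp.two_le 3
      _ ≤ p ^ (N + 3) := Nat.pow_le_pow_right hp.pos (by omega)
  have hnN : N ≤ n := by
    rw [hn]
    exact le_trans (by omega) (Nat.lt_pow_self hp.one_lt).le
  have : NeZero n := ⟨by omega⟩
  have hW : IsPGroup p (BW n × BW n × BW n) := by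
    refine IsPGroup.of_card (n := ((N + 3) * n + (N + 3)) * 3) ?_
    rw [Nat.card_prod, Nat.card_prod, BW.card]
    have : n ^ n * n = p ^ ((N + 3) * n + (N + 3)) := by
      rw [pow_add, pow_mul, ← hn]
    rw [this, pow_mul]; ring
  let X : BW n × BW n × BW n := (BW.d n, BW.t n, BW.d n * BW.t n)
  let Y : BW n × BW n × BW n := (BW.t n, BW.d n, (BW.t n)⁻¹)
  let G := Subgroup.closure ({X, Y} : Set (BW n × BW n × BW n))
  have hXG : X ∈ G := Subgroup.subset_closure (by simp)
  have hYG : Y ∈ G := Subgroup.subset_closure (by simp)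
  refine ⟨G, inferInstance, inferInstance, hW.to_subgroup G, ?_, ?_⟩
  · refine hnN.trans (le_trans ?_ (orderOf_le_card (x := (⟨X, hXG⟩ : G))))
    refine Nat.le_of_dvd (orderOf_pos _) ?_
    have h := congrArg (fun g : G => g.1.2.1) (pow_orderOf_eq_one (⟨X, hXG⟩ : G))
    have h2 := congrArg BW.q h
    have h3 := BW.zpow_q (BW.t n) (orderOf (⟨X, hXG⟩ : G) : ℤ)
    rw [zpow_natCast] at h3
    have h4 : ((BW.t n) ^ (orderOf (⟨X, hXG⟩ : G))).q = 0 := h2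
    rw [h4] at h3
    rw [← ZMod.natCast_eq_zero_iff]
    simpa using h3.symm
  · refine beauville_main (hW.to_subgroup G) hn8 ⟨X, hXG⟩ ⟨Y, hYG⟩ ?_
      ((MonoidHom.fst _ _).comp G.subtype)
      ((MonoidHom.fst _ _).comp ((MonoidHom.snd _ _).comp G.subtype))
      ((MonoidHom.snd _ _).comp ((MonoidHom.snd _ _).comp G.subtype)) ?_ rfl rfl rfl rfl rfl rfl
    · have := Subgroup.closure_closure_coe_preimage (k := ({X, Y} : Set (BW n × BW n × BW n)))
      convert this using 2
      ext g
      simp [Subtype.ext_iff]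
    · intro g h1 h2 h3
      exact Subtype.ext (Prod.ext h1 (Prod.ext h2 h3))
end
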